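/- For complex s with -1 < Re(s) < 0, ∫_0^∞ (1/(e^x - 1) - 1/x + 1/2) x^{s-1} dx = 2 ∑_{n=1}^∞ (2nπ)^{s-1} · π/(2 cos(πs/2)) = (2^{s-1} π^s / cos(πs/2)) · ζ(1-s). -/

import Mathlib

open Real

open MeasureTheory in
/-- The Mellin transform of `1 / (1 + t)`. -/
lemma hasMellin_one_add_inv {w : ℂ} (h0 : 0 < w.re) (h1 : w.re < 1) :
    HasMellin (fun t : ℝ ↦ ((1 + t : ℝ) : ℂ)⁻¹) w (π / Complex.sin (π * w)) := by
  have himg : (fun t : ℝ ↦ t / (1 - t)) '' Set.Ioo 0 1 = Set.Ioi 0 := by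
    ext y
    constructor
    · rintro ⟨t, ⟨ht0, ht1⟩, rfl⟩
      exact div_pos ht0 (sub_pos.2 ht1)
    · intro (hy : 0 < y)
      refine ⟨y / (1 + y), ⟨by positivity, (div_lt_one (by positivity)).2 (by linarith)⟩, ?_⟩
      have : 1 + y ≠ 0 := by positivity
      simp only
      field_simp
      simp
  have hinj : Set.InjOn (fun t : ℝ ↦ t / (1 - t)) (Set.Ioo 0 1) := by
    rintro x ⟨_, hx⟩ y ⟨_, hy⟩ hxy
    have hx' : 1 - x ≠ 0 := by linarith
    have hy' : 1 - y ≠ 0 := by linarith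
    simp only at hxy
    rw [div_eq_div_iff hx' hy'] at hxy
    linarith
  have hderiv : ∀ t ∈ Set.Ioo (0 : ℝ) 1,
      HasDerivWithinAt (fun t : ℝ ↦ t / (1 - t)) (1 / (1 - t) ^ 2) (Set.Ioo 0 1) t := by
    rintro t ⟨_, ht⟩
    have ht' : 1 - t ≠ 0 := by linarith
    convert! ((hasDerivAt_id t).div ((hasDerivAt_id t).const_sub 1) ht').hasDerivWithinAt using 1
    simp
  have hEq : Set.EqOn
      (fun t : ℝ ↦ |1 / (1 - t) ^ 2| • (((t / (1 - t) : ℝ) : ℂ) ^ (w - 1) •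
        ((1 + t / (1 - t) : ℝ) : ℂ)⁻¹))
      (fun t : ℝ ↦ (t : ℂ) ^ (w - 1) * (1 - (t : ℂ)) ^ ((1 - w) - 1)) (Set.Ioo 0 1) := by
    rintro t ⟨ht0, ht1⟩
    have ht : 0 < 1 - t := sub_pos.2 ht1
    have htc : ((1 - t : ℝ) : ℂ) ≠ 0 := Complex.ofReal_ne_zero.2 ht.ne'
    have e1 : (1 + t / (1 - t) : ℝ) = (1 - t)⁻¹ := by field_simp; ring
    simp only
    rw [abs_of_pos (by positivity), e1, div_eq_mul_inv t, Complex.ofReal_mul,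
      Complex.mul_cpow_ofReal_nonneg ht0.le (by positivity), Complex.ofReal_inv, Complex.inv_cpow,
      ← Complex.cpow_neg, Complex.real_smul, smul_eq_mul]
    · have e2 : (1 - (t : ℂ)) ^ (1 - w - 1) = (1 - (t : ℂ)) ^ (-(w - 1)) / (1 - (t : ℂ)) := by
        push_cast at htc
        rw [show 1 - w - 1 = -(w - 1) - 1 by ring, Complex.cpow_sub _ _ htc, Complex.cpow_one]
      rw [e2]
      push_cast at htc ⊢
      field_simp
    · rw [Complex.arg_ofReal_of_nonneg ht.le]
      exact pi_pos.ne
  have hre : 0 < (1 - w).re := by simpa using h1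
  constructor
  · rw [MellinConvergent, ← himg, integrableOn_image_iff_integrableOn_abs_deriv_smul
      measurableSet_Ioo hderiv hinj, integrableOn_congr_fun hEq measurableSet_Ioo,
      ← intervalIntegrable_iff_integrableOn_Ioo_of_le zero_le_one]
    exact Complex.betaIntegral_convergent h0 hre
  · rw [mellin, ← himg, integral_image_eq_integral_abs_deriv_smul measurableSet_Ioo hderiv hinj,
      setIntegral_congr_fun measurableSet_Ioo hEq, ← integral_Ioc_eq_integral_Ioo,
      ← intervalIntegral.integral_of_le zero_le_one]
    change Complex.betaIntegral w (1 - w) = _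
    rw [Complex.betaIntegral_eq_Gamma_mul_div _ _ h0 hre, add_sub_cancel, Complex.Gamma_one,
      div_one, Complex.Gamma_mul_Gamma_one_sub]

/-- The Mellin transform of `1 / (1 + t ^ 2)`. -/
lemma hasMellin_one_add_sq_inv {s : ℂ} (h0 : -1 < s.re) (h1 : s.re < 1) :
    HasMellin (fun t : ℝ ↦ ((1 + t ^ 2 : ℝ) : ℂ)⁻¹) (s + 1)
      (π / (2 * Complex.cos (π * s / 2))) := by
  have hre : ((s + 1) / 2).re = (s.re + 1) / 2 := by
    rw [show (2 : ℂ) = ((2 : ℝ) : ℂ) by norm_num, Complex.div_ofReal_re]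
    simp
  obtain ⟨hc, hv⟩ := hasMellin_one_add_inv (w := (s + 1) / 2)
    (by rw [hre]; linarith) (by rw [hre]; linarith)
  have h2 : ((2 : ℝ) : ℂ) = 2 := by norm_num
  constructor
  · simpa using! (MellinConvergent.comp_rpow
      (f := fun t : ℝ ↦ ((1 + t : ℝ) : ℂ)⁻¹) (s := s + 1) (a := 2) two_ne_zero).2 (by simpa using hc)
  · have := mellin_comp_rpow (fun t : ℝ ↦ ((1 + t : ℝ) : ℂ)⁻¹) (s + 1) 2
    simp only [rpow_two, h2, hv] at this
    rw [this, show (π : ℂ) * ((s + 1) / 2) = π * s / 2 + π / 2 by ring, Complex.sin_add_pi_div_two,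
      Complex.real_smul]
    norm_num
    ring

open MeasureTheory in
lemma integrableOn_cpow_div_sq_add_sq {s : ℂ} (h0 : -1 < s.re) (h1 : s.re < 1) {a : ℝ}
    (ha : 0 < a) :
    IntegrableOn (fun x : ℝ ↦ (x : ℂ) ^ s / ((x ^ 2 + a ^ 2 : ℝ) : ℂ)) (Set.Ioi 0) := by
  have h := (((MellinConvergent.comp_mul_left (inv_pos.2 ha)).2
    (hasMellin_one_add_sq_inv h0 h1).1).const_smul ((a : ℂ) ^ 2)⁻¹)
  refine h.congr_fun (fun x _ ↦ ?_) measurableSet_Ioi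
  have : (a : ℂ) ≠ 0 := Complex.ofReal_ne_zero.2 ha.ne'
  simp only [smul_eq_mul, add_sub_cancel_right, div_eq_mul_inv, ← mul_inv]
  congr 2
  push_cast
  field_simp
  ring

open MeasureTheory in
lemma integral_cpow_div_sq_add_sq {s : ℂ} (h0 : -1 < s.re) (h1 : s.re < 1) {a : ℝ} (ha : 0 < a) :
    ∫ x in Set.Ioi (0 : ℝ), (x : ℂ) ^ s / ((x ^ 2 + a ^ 2 : ℝ) : ℂ)
      = (a : ℂ) ^ (s - 1) * π / (2 * Complex.cos (π * s / 2)) := by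
  have hac : (a : ℂ) ≠ 0 := Complex.ofReal_ne_zero.2 ha.ne'
  have h := mellin_comp_mul_left (fun t : ℝ ↦ ((1 + t ^ 2 : ℝ) : ℂ)⁻¹) (s + 1) (inv_pos.2 ha)
  rw [(hasMellin_one_add_sq_inv h0 h1).2] at h
  have h' : ∫ x in Set.Ioi (0 : ℝ), (x : ℂ) ^ s / ((x ^ 2 + a ^ 2 : ℝ) : ℂ) =
      ((a : ℂ) ^ 2)⁻¹ * mellin (fun t : ℝ ↦ ((1 + (a⁻¹ * t) ^ 2 : ℝ) : ℂ)⁻¹) (s + 1) := by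
    rw [mellin, ← integral_const_mul]
    refine setIntegral_congr_fun measurableSet_Ioi fun x _ ↦ ?_
    simp only [smul_eq_mul, add_sub_cancel_right, div_eq_mul_inv]
    rw [mul_left_comm, ← mul_inv]
    congr 2
    push_cast
    field_simp
    ring
  rw [h', h, Complex.ofReal_inv, Complex.inv_cpow, ← Complex.cpow_neg, neg_neg,
    show s - 1 = s + 1 - (2 : ℕ) by push_cast; ring, Complex.cpow_sub _ _ hac,
    Complex.cpow_natCast, smul_eq_mul]
  · field_simp
  · rw [Complex.arg_ofReal_of_nonneg ha.le]
    exact pi_pos.ne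

/-- The partial fraction expansion of `1 / (exp x - 1) - 1 / x + 1 / 2`. -/
lemma hasSum_two_mul_div_sq_add_sq {x : ℝ} (hx : 0 < x) :
    HasSum (fun n : ℕ ↦ 2 * ((x : ℂ) / ((x ^ 2 + (2 * (n + 1) * π) ^ 2 : ℝ) : ℂ)))
      ((1 / (Real.exp x - 1) - 1 / x + 1 / 2 : ℝ) : ℂ) := by
  set z : ℂ := Complex.I * x / (2 * π) with hz
  have hpi : (π : ℂ) ≠ 0 := Complex.ofReal_ne_zero.2 pi_ne_zero
  have hxc : (x : ℂ) ≠ 0 := Complex.ofReal_ne_zero.2 hx.ne'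
  have hzim : z = ((x / (2 * π) : ℝ) : ℂ) * Complex.I := by
    rw [hz]; push_cast; ring
  have hzc : z ∈ Complex.integerComplement := by
    rintro ⟨n, hn⟩
    have := congrArg Complex.im hn
    rw [hzim, Complex.im_ofReal_mul, Complex.intCast_im, Complex.I_im, mul_one] at this
    have : 0 < x / (2 * π) := by positivity
    linarith
  have hsum := (summable_cotTerm hzc).hasSum
  have hval : ∑' n : ℕ, cotTerm z n = _ := (cot_series_rep' hzc).symm
  rw [hval] at hsum
  have hsum := hsum.mul_left (Complex.I / (2 * π))
  convert! hsum using 1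
  · ext n
    rw [cotTerm_identity hzc, ← mul_assoc]
    have hne : ((x ^ 2 + (2 * (n + 1) * π) ^ 2 : ℝ) : ℂ) ≠ 0 :=
      Complex.ofReal_ne_zero.2 (by positivity)
    have key : (z + (n + 1)) * (z - (n + 1)) =
        -(((x ^ 2 + (2 * (n + 1) * π) ^ 2 : ℝ) : ℂ) / (2 * π) ^ 2) := by
      rw [hz]
      push_cast
      field_simp
      ring_nf
      rw [Complex.I_sq]
      ring
    rw [key, hz]
    generalize ((x ^ 2 + (2 * (n + 1) * π) ^ 2 : ℝ) : ℂ) = d at hne ⊢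
    field_simp
    rw [Complex.I_sq]
    ring
  · have hexp : Complex.exp x - 1 ≠ 0 := by
      have : Real.exp x - 1 ≠ 0 := (sub_pos.2 (Real.one_lt_exp_iff.2 hx)).ne'
      exact_mod_cast this
    have hexp0 := Complex.exp_ne_zero x
    have e : Complex.exp (2 * π * Complex.I * z) = (Complex.exp x)⁻¹ := by
      rw [← Complex.exp_neg]
      congr 1
      rw [hz]
      field_simp
      rw [Complex.I_sq]
    rw [Complex.cot_pi_eq_exp_ratio, e, hz]
    have h1 : 1 - (Complex.exp x)⁻¹ ≠ 0 := by
      intro h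
      apply hexp
      field_simp at h
      simpa using h
    push_cast
    have e3 : (Complex.exp x)⁻¹ + 1 =
        (1 - (Complex.exp x)⁻¹) * ((Complex.exp x + 1) / (Complex.exp x - 1)) := by
      field_simp
      ring
    rw [e3]
    generalize 1 - (Complex.exp x)⁻¹ = d at h1 ⊢
    field_simp
    ring_nf

/-- Titchmarsh's derivation of the functional equation: for `-1 < Re s < 0`,
`∫_0^∞ (1/(e^x-1) - 1/x + 1/2) x^{s-1} dx = 2 ∑_n (2nπ)^{s-1} π/(2cos(πs/2))
= (2^{s-1}π^s/cos(πs/2)) ζ(1-s)` where `ζ(1-s) = ∑_n n^{s-1}`. -/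
theorem titchmarsh_functional_equation (s : ℂ) (hs1 : -1 < s.re) (hs0 : s.re < 0) :
    (∫ x in Set.Ioi (0 : ℝ),
        ((1 / (Real.exp x - 1) - 1 / x + 1 / 2 : ℝ) : ℂ) * (x : ℂ) ^ (s - 1))
      = 2 * ∑' n : ℕ, (2 * ((n : ℂ) + 1) * (π : ℂ)) ^ (s - 1)
          * (π : ℂ) / (2 * Complex.cos ((π : ℂ) * s / 2)) ∧
    2 * (∑' n : ℕ, (2 * ((n : ℂ) + 1) * (π : ℂ)) ^ (s - 1)
          * (π : ℂ) / (2 * Complex.cos ((π : ℂ) * s / 2)))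
      = 2 ^ (s - 1) * (π : ℂ) ^ s / Complex.cos ((π : ℂ) * s / 2)
          * ∑' n : ℕ, ((n : ℂ) + 1) ^ (s - 1) := by
  have ha (n : ℕ) : 0 < 2 * ((n : ℝ) + 1) * π := by positivity
  have hpi : (π : ℂ) ≠ 0 := Complex.ofReal_ne_zero.2 pi_ne_zero
  have hsplit (w : ℂ) (n : ℕ) : (2 * ((n : ℂ) + 1) * (π : ℂ)) ^ w
      = 2 ^ w * (π : ℂ) ^ w * ((n : ℂ) + 1) ^ w := by
    have h1 := Complex.mul_cpow_ofReal_nonneg (a := 2 * ((n : ℝ) + 1)) (b := π)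
      (by positivity) pi_pos.le w
    have h2 := Complex.mul_cpow_ofReal_nonneg (a := 2) (b := (n : ℝ) + 1)
      (by positivity) (by positivity) w
    push_cast at h1 h2
    rw [h1, h2]
    ring
  have hterm (w : ℂ) (n : ℕ) : (2 * ((n : ℂ) + 1) * (π : ℂ)) ^ (w - 1)
      * (π : ℂ) / (2 * Complex.cos ((π : ℂ) * w / 2))
      = 2 ^ (w - 1) * (π : ℂ) ^ w / (2 * Complex.cos ((π : ℂ) * w / 2))
        * ((n : ℂ) + 1) ^ (w - 1) := by
    rw [hsplit, Complex.cpow_sub _ _ hpi, Complex.cpow_one]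
    field_simp
  have hint (w : ℂ) (hw1 : -1 < w.re) (hw0 : w.re < 0) (n : ℕ) :
      ∫ x in Set.Ioi (0 : ℝ), 2 * ((x : ℂ) ^ w / ((x ^ 2 + (2 * (n + 1) * π) ^ 2 : ℝ) : ℂ))
        = 2 * ((2 * ((n : ℂ) + 1) * (π : ℂ)) ^ (w - 1) * (π : ℂ)
          / (2 * Complex.cos ((π : ℂ) * w / 2))) := by
    rw [MeasureTheory.integral_const_mul, integral_cpow_div_sq_add_sq hw1 (by linarith) (ha n)]
    push_cast
    rfl
  refine ⟨?_, ?_⟩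
  · have hnorm (n : ℕ) : ((∫ x in Set.Ioi (0 : ℝ),
        ‖2 * ((x : ℂ) ^ s / ((x ^ 2 + (2 * (n + 1) * π) ^ 2 : ℝ) : ℂ))‖ : ℝ) : ℂ)
        = 2 * ((2 * ((n : ℂ) + 1) * (π : ℂ)) ^ ((s.re : ℂ) - 1) * (π : ℂ)
          / (2 * Complex.cos ((π : ℂ) * s.re / 2))) := by
      rw [← hint s.re (by simpa using hs1) (by simpa using hs0), ← integral_complex_ofReal]
      refine MeasureTheory.setIntegral_congr_fun measurableSet_Ioi fun x hx ↦ ?_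
      have hx : 0 < x := hx
      have hd : 0 ≤ x ^ 2 + (2 * ((n : ℝ) + 1) * π) ^ 2 := by positivity
      simp only [norm_mul, norm_div, Complex.norm_cpow_eq_rpow_re_of_pos hx, Complex.norm_real,
        Real.norm_of_nonneg hd, Complex.norm_ofNat]
      rw [← Complex.ofReal_cpow hx.le]
      push_cast
      rfl
    have hsum : Summable fun n : ℕ ↦ ∫ x in Set.Ioi (0 : ℝ),
        ‖2 * ((x : ℂ) ^ s / ((x ^ 2 + (2 * (n + 1) * π) ^ 2 : ℝ) : ℂ))‖ := by
      rw [← Complex.summable_ofReal]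
      simp_rw [hnorm, hterm]
      refine (Summable.mul_left _ ?_).mul_left _
      have h := (summable_nat_add_iff 1).2
        (Real.summable_nat_rpow.2 (show s.re - 1 < -1 by linarith))
      refine (Complex.summable_ofReal.2 h).congr fun n ↦ ?_
      rw [Complex.ofReal_cpow (by positivity)]
      push_cast
      rfl
    rw [← tsum_mul_left, ← tsum_congr (hint s hs1 hs0),
      MeasureTheory.integral_tsum_of_summable_integral_norm
        (fun n ↦ (integrableOn_cpow_div_sq_add_sq hs1 (by linarith) (ha n)).const_mul 2) hsum]
    refine MeasureTheory.setIntegral_congr_fun measurableSet_Ioi fun x hx ↦ ?_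
    have hx0 : (x : ℂ) ≠ 0 := Complex.ofReal_ne_zero.2 (ne_of_gt hx)
    rw [← (hasSum_two_mul_div_sq_add_sq hx).tsum_eq, ← tsum_mul_right]
    refine tsum_congr fun n ↦ ?_
    rw [Complex.cpow_sub _ _ hx0, Complex.cpow_one]
    field_simp
  · simp_rw [hterm, tsum_mul_left]
    field_simp
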